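/- Let G be a bridgeless cubic graph and let F be an inclusion-wise maximal 1^+-factor subject to not being extendable to a quelling pair via a perfect matching through a fixed edge e. Then every connected component of G \ F is an odd circuit; in particular F is a parity subgraph (join) of G. -/

import Mathlib

namespace SimpleGraph

/-- If adding the edge `s(v, w)` to a bipartite graph destroys bipartiteness, then `v` and `w` are
joined by a path of even length. -/
theorem Colorable.exists_isPath_even_length {V : Type*} {K K' : SimpleGraph V} {v w : V}
    (hK : K.Colorable 2) (hK' : ¬ K'.Colorable 2)
    (hadj : ∀ x y, K'.Adj x y → K.Adj x y ∨ s(x, y) = s(v, w)) :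
    ∃ p : K.Walk v w, p.IsPath ∧ Even p.length := by
  classical
  let c : K.Coloring Bool := hK.toColoring (by simp)
  have not_coloring (f : V → Bool) (hf : ∀ x y, K.Adj x y → f x ≠ f y) : f v = f w := by
    by_contra hne
    refine hK' (Coloring.colorable (α := Bool) (Coloring.mk f fun {x y} hxy ↦ ?_))
    rcases hadj x y hxy with h | h
    · exact hf x y h
    · rcases Sym2.eq_iff.mp h with ⟨rfl, rfl⟩ | ⟨rfl, rfl⟩
      · exact hne
      · exact Ne.symm hne
  have hc : c v = c w := not_coloring c fun x y h ↦ c.valid h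
  by_cases hr : K.Reachable v w
  · obtain ⟨p, hp⟩ := hr.exists_isPath
    exact ⟨p, hp, (c.even_length_iff_congr p).mpr (by rw [hc])⟩
  · have hflip := not_coloring (fun x ↦ if K.Reachable v x then !c x else c x) fun x y h ↦ by
      have hiff : K.Reachable v x ↔ K.Reachable v y :=
        ⟨fun hx ↦ hx.trans h.reachable, fun hy ↦ hy.trans h.symm.reachable⟩
      have := c.valid h
      by_cases hx : K.Reachable v x
      · simpa [hx, hiff.mp hx] using this
      · simpa [hx, mt hiff.mpr hx] using this
    simp [hr, hc] at hflip

/-- In a graph of maximum degree at most two, the neighbours of a vertex of a cycle are its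
neighbours along the cycle. -/
theorem Walk.IsCycle.neighborSet_toSubgraph_eq {V : Type*} [Finite V] {H : SimpleGraph V} {u x : V}
    {p : H.Walk u u} (hp : p.IsCycle) (hdeg : (H.neighborSet x).ncard ≤ 2) (hx : x ∈ p.support) :
    p.toSubgraph.neighborSet x = H.neighborSet x :=
  Set.eq_of_subset_of_ncard_le (p.toSubgraph.neighborSet_subset x)
    (hdeg.trans_eq (hp.ncard_neighborSet_toSubgraph_eq_two hx).symm) (Set.toFinite _)

/-- In a graph of maximum degree at most two, the edges of the component of a cycle are the edges of
that cycle. -/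
theorem Walk.IsCycle.edgeSet_inter_component {V : Type*} [Finite V] {H : SimpleGraph V} {u : V}
    {p : H.Walk u u} (hp : p.IsCycle) (hdeg : ∀ x, (H.neighborSet x).ncard ≤ 2) :
    H.edgeSet ∩ {ed | ∀ x ∈ ed, H.connectedComponentMk x = H.connectedComponentMk u} =
      p.edgeSet := by
  have step {x y : V} (hx : x ∈ p.support) (hxy : H.Adj x y) : s(x, y) ∈ p.edges := by
    have : y ∈ p.toSubgraph.neighborSet x := by
      rw [hp.neighborSet_toSubgraph_eq (hdeg x) hx]
      exact hxy
    exact adj_toSubgraph_iff_mem_edges.mp this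
  have closed {x y : V} (q : H.Walk x y) (hx : x ∈ p.support) : y ∈ p.support := by
    induction q with
    | nil => exact hx
    | cons h _ ih => exact ih (p.snd_mem_support_of_mem_edges (step hx h))
  ext ed
  induction ed with
  | h a b =>
    constructor
    · rintro ⟨hab, hcomp⟩
      obtain ⟨q⟩ := (ConnectedComponent.exact (hcomp a (Sym2.mem_mk_left a b))).symm
      exact step (closed q p.start_mem_support) hab
    · intro hab
      refine ⟨p.edges_subset_edgeSet hab, fun x hx ↦ ConnectedComponent.sound ?_⟩
      have hxs : x ∈ p.support := by
        rcases Sym2.mem_iff.mp hx with rfl | rfl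
        · exact p.fst_mem_support_of_mem_edges hab
        · exact p.snd_mem_support_of_mem_edges hab
      classical exact (p.takeUntil x hxs).reachable.symm

theorem Walk.IsTrail.ncard_edgeSet {V : Type*} {H : SimpleGraph V} {u v : V}
    {p : H.Walk u v} (hp : p.IsTrail) : p.edgeSet.ncard = p.length := by
  classical
  have : p.edgeSet = (p.edges.toFinset : Set (Sym2 V)) := by
    ext
    simp
  rw [this, Set.ncard_coe_finset, List.toFinset_card_of_nodup hp.edges_nodup, p.length_edges]

/-- The degree of a vertex in a subgraph and in its complement add up to the degree in `G`. -/
theorem Subgraph.ncard_neighborSet_add_deleteEdges {V : Type*} [Finite V] {G : SimpleGraph V}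
    (F : G.Subgraph) (v : V) :
    (F.neighborSet v).ncard + ((G.deleteEdges F.edgeSet).neighborSet v).ncard =
      (G.neighborSet v).ncard := by
  have : (G.deleteEdges F.edgeSet).neighborSet v = G.neighborSet v \ F.neighborSet v := by
    ext
    simp
  rw [this, add_comm, Set.ncard_sdiff_add_ncard_of_subset (F.neighborSet_subset v)]

end SimpleGraph

open SimpleGraph in

/-- Let `G` be a bridgeless cubic graph, `e` an edge of `G`, and `F` a `1⁺`-factor of `G`
that cannot be extended to a quelling pair by a perfect matching through `e`, and which is
inclusion-wise maximal with this property. Then every vertex has odd degree in `F`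
(i.e. `F` is a parity subgraph), every vertex has degree `0` or `2` in `G \ F`, and every
connected component of `G \ F` is either a single vertex or has an odd number of edges,
i.e. every nontrivial component of `G \ F` is an odd circuit. -/
theorem maximal_nonextendable_factor_is_join {V : Type*} [Fintype V] (G : SimpleGraph V)
    (hcubic : ∀ v : V, (G.neighborSet v).ncard = 3)
    (hbridgeless : ∀ e : Sym2 V, ¬ G.IsBridge e)
    (e : Sym2 V) (he : e ∈ G.edgeSet)
    (F : G.Subgraph) (hFspan : F.IsSpanning)
    (hFdeg : ∀ v : V, (F.neighborSet v).Nonempty)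
    (hnotext : ¬ ∃ M : G.Subgraph, M.IsPerfectMatching ∧ e ∈ M.edgeSet ∧
      (G.deleteEdges (F.edgeSet ∪ M.edgeSet)).Colorable 2)
    (hmax : ∀ F' : G.Subgraph, F'.IsSpanning → (∀ v : V, (F'.neighborSet v).Nonempty) →
      F < F' → ∃ M : G.Subgraph, M.IsPerfectMatching ∧ e ∈ M.edgeSet ∧
        (G.deleteEdges (F'.edgeSet ∪ M.edgeSet)).Colorable 2) :
    (∀ v : V, Odd ((F.neighborSet v).ncard)) ∧
    (∀ v : V, ((G.deleteEdges F.edgeSet).neighborSet v).ncard = 0 ∨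
      ((G.deleteEdges F.edgeSet).neighborSet v).ncard = 2) ∧
    ∀ c : (G.deleteEdges F.edgeSet).ConnectedComponent, c.supp.ncard = 1 ∨
      Odd (((G.deleteEdges F.edgeSet).edgeSet ∩
        {ed : Sym2 V | ∀ w ∈ ed,
          (G.deleteEdges F.edgeSet).connectedComponentMk w = c}).ncard) := by
  set H := G.deleteEdges F.edgeSet with hH
  have hsum (v : V) := (F.ncard_neighborSet_add_deleteEdges v).trans (hcubic v)
  rw [← hH] at hsum
  have hpos (v : V) : 0 < (F.neighborSet v).ncard :=
    (Set.ncard_pos (Set.toFinite _)).mpr (hFdeg v)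
  have hdeg (v : V) : (H.neighborSet v).ncard ≤ 2 := by grind
  have hcycle {v w : V} (hvw : H.Adj v w) : ∃ p : H.Walk v v, p.IsCycle ∧ Odd p.length := by
    obtain ⟨hG, hF⟩ := deleteEdges_adj.mp hvw
    have hlt : F < F ⊔ G.subgraphOfAdj hG := by
      refine lt_of_le_of_ne le_sup_left fun h ↦ hF ?_
      rw [h]
      simp
    obtain ⟨M, hM, heM, hcol⟩ := hmax (F ⊔ G.subgraphOfAdj hG) (fun x ↦ Or.inl (hFspan x))
      (fun x ↦ (hFdeg x).mono fun y hy ↦ Or.inl hy) hlt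
    obtain ⟨p, hp, hpe⟩ := hcol.exists_isPath_even_length (v := w) (w := v)
      (fun h ↦ hnotext ⟨M, hM, heM, h⟩) (fun x y hxy ↦ by
        simp only [deleteEdges_adj, Subgraph.edgeSet_sup, edgeSet_subgraphOfAdj, Set.mem_union,
          Set.mem_singleton_iff] at hxy ⊢
        grind [Sym2.eq_swap])
    have hle : G.deleteEdges ((F ⊔ G.subgraphOfAdj hG).edgeSet ∪ M.edgeSet) ≤ H :=
      deleteEdges_anti (by rw [Subgraph.edgeSet_sup]; grind)
    refine ⟨.cons hvw (p.mapLe hle), (Walk.cons_isCycle_iff _ _).mpr ⟨hp.mapLe hle, fun hmem ↦ ?_⟩,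
      by simpa using hpe.add_one⟩
    rw [Walk.edges_mapLe_eq_edges] at hmem
    simpa using p.edges_subset_edgeSet hmem
  have hdeg' (v : V) : (H.neighborSet v).ncard = 0 ∨ (H.neighborSet v).ncard = 2 := by
    rcases (H.neighborSet v).eq_empty_or_nonempty with h | ⟨w, hw⟩
    · simp [h]
    · obtain ⟨p, hp, -⟩ := hcycle hw
      right
      rw [← hp.neighborSet_toSubgraph_eq (hdeg v) p.start_mem_support]
      exact hp.ncard_neighborSet_toSubgraph_eq_two p.start_mem_support
  refine ⟨fun v ↦ ?_, hdeg', fun c ↦ ?_⟩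
  · rcases hdeg' v with h | h
    · exact ⟨1, by grind⟩
    · exact ⟨0, by grind⟩
  · induction c using ConnectedComponent.ind with
    | h v =>
      rcases (H.neighborSet v).eq_empty_or_nonempty with h | ⟨w, hw⟩
      · left
        rw [Set.ncard_eq_one]
        refine ⟨v, Set.eq_singleton_iff_unique_mem.mpr ⟨rfl, fun x hx ↦ ?_⟩⟩
        obtain ⟨q⟩ := (ConnectedComponent.exact hx).symm
        cases q with
        | nil => rfl
        | cons hadj _ => exact absurd hadj (Set.eq_empty_iff_forall_notMem.mp h _)
      · right
        obtain ⟨p, hp, hodd⟩ := hcycle hw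
        rwa [hp.edgeSet_inter_component hdeg, hp.isTrail.ncard_edgeSet]
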